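/- Let α, β ∈ (0,1), λ > 0, f(p) = p + λ(2β/p − 4(1−α)), s = √(2λβ), and E = [f(s), f²(s) + s]. Assume β/(8(1−α)²) < λ < β/(2(1−α)²). Then the restriction of f to E has a periodic point of odd period greater than 1 if and only if 25β/(72(1−α)²) < λ. -/

import Mathlib

open Set Function Filter Topology

/-- The price adjustment map in the units where its critical point is `1`. -/
noncomputable def normMap (c y : ℝ) : ℝ := y + y⁻¹ - c

namespace normMap

variable {c y : ℝ}

lemma apply_one (c : ℝ) : normMap c 1 = 2 - c := by
  norm_num [normMap]

lemma ge_of_pos (hy : 0 < y) : 2 - c ≤ normMap c y := by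
  have h : y + y⁻¹ - c - (2 - c) = (y - 1) ^ 2 / y := by field_simp; ring
  have : 0 ≤ (y - 1) ^ 2 / y := by positivity
  unfold normMap
  linarith

lemma mapsTo_Ioi (hc : c < 2) : MapsTo (normMap c) (Ioi 0) (Ioi 0) := fun y hy => by
  have := ge_of_pos (c := c) (mem_Ioi.1 hy)
  rw [mem_Ioi]
  linarith

lemma iterate_pos (hc : c < 2) (hy : 0 < y) (k : ℕ) : 0 < (normMap c)^[k] y :=
  (mapsTo_Ioi hc).iterate k hy

lemma continuousOn_Ioi (c : ℝ) : ContinuousOn (normMap c) (Ioi 0) :=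
  (continuousOn_id.add (continuousOn_id.inv₀ fun _ hy => (mem_Ioi.1 hy).ne')).sub
    continuousOn_const

lemma continuousOn_iterate (hc : c < 2) (k : ℕ) : ContinuousOn (normMap c)^[k] (Ioi 0) :=
  (continuousOn_Ioi c).iterate (mapsTo_Ioi hc) k

lemma le_self (hc : 0 < c) (hy : c⁻¹ ≤ y) : normMap c y ≤ y := by
  have := inv_le_of_inv_le₀ hc hy
  unfold normMap
  linarith

lemma lt_self (hc : 0 < c) (hy : c⁻¹ < y) : normMap c y < y := by
  have := inv_lt_of_inv_lt₀ hc hy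
  unfold normMap
  linarith

lemma apply_eq_self (hy : normMap c y = y) : y = c⁻¹ := by
  have : y⁻¹ = c := by unfold normMap at hy; linarith
  rw [← this, inv_inv]

lemma apply_inv (c : ℝ) : normMap c c⁻¹ = c⁻¹ := by
  simp [normMap]

lemma apply_param (c : ℝ) : normMap c c = c⁻¹ := by
  simp [normMap]

lemma antitoneOn_Ioc (c : ℝ) : AntitoneOn (normMap c) (Ioc 0 1) := fun x hx y hy hxy => by
  have hx0 := hx.1
  have hy0 := hy.1
  have h : x + x⁻¹ - c - (y + y⁻¹ - c) = (y - x) * (1 - x * y) / (x * y) := by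
    field_simp; ring
  have hxy1 : x * y ≤ 1 := mul_le_one₀ hx.2 hy0.le hy.2
  have : 0 ≤ (y - x) * (1 - x * y) / (x * y) :=
    div_nonneg (mul_nonneg (by linarith) (by linarith)) (by positivity)
  unfold normMap
  linarith

lemma apply_le_inv (hc : 0 < c) (h₁ : c⁻¹ ≤ y) (h₂ : y ≤ c) : normMap c y ≤ c⁻¹ := by
  have hy : 0 < y := (inv_pos.2 hc).trans_le h₁
  have h : c⁻¹ - (y + y⁻¹ - c) = (y - c⁻¹) * (c - y) / y := by field_simp; ring
  have : 0 ≤ (y - c⁻¹) * (c - y) / y :=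
    div_nonneg (mul_nonneg (by linarith) (by linarith)) hy.le
  unfold normMap
  linarith

lemma inv_lt_apply (hc : 1 < c) (hy : c < y) : c⁻¹ < normMap c y := by
  have hy0 : 0 < y := by linarith
  have h : (y + y⁻¹ - c) - c⁻¹ = (y - c⁻¹) * (y - c) / y := by field_simp; ring
  have hci : c⁻¹ < 1 := inv_lt_one_of_one_lt₀ hc
  have : 0 < (y - c⁻¹) * (y - c) / y :=
    div_pos (mul_pos (by linarith) (by linarith)) hy0
  unfold normMap
  linarith

lemma lt_apply_apply_one_iff (h₁ : 1 < c) (h₂ : c < 2) :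
    c < normMap c (normMap c 1) ↔ 5 / 3 < c := by
  have h : (2 - c + (2 - c)⁻¹ - c) - c = (3 * c - 5) * (c - 1) / (2 - c) := by
    have : 2 - c ≠ 0 := by linarith
    field_simp; ring
  rw [apply_one, normMap, ← sub_pos, h, div_pos_iff_of_pos_right (by linarith),
    mul_pos_iff_of_pos_right (by linarith)]
  constructor <;> intro <;> linarith

lemma lt_apply_apply (hc : 5 / 3 < c) (hc2 : c < 2) (h₁ : c⁻¹ < y) (h₂ : y ≤ 1) :
    y < normMap c (normMap c y) := by
  have hc0 : 0 < c := by linarith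
  have hy : 0 < y := (inv_pos.2 hc0).trans h₁
  have hw : 0 < normMap c y := mapsTo_Ioi hc2 hy
  have hwy : normMap c y = (y ^ 2 - c * y + 1) / y := by
    unfold normMap; field_simp; ring
  have hq : 0 < y ^ 2 - c * y + 1 := by
    rw [hwy] at hw
    exact (div_pos_iff_of_pos_right hy).1 hw
  have hcy : 1 < c * y := by
    have := (inv_lt_iff_one_lt_mul₀' hc0).1 h₁
    linarith
  have key : normMap c (normMap c y) - y =
      (c * y - 1) * (2 * c * y - 2 * y ^ 2 - 1) / (y * (y ^ 2 - c * y + 1)) := by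
    rw [normMap, hwy]
    obtain ⟨q, hqy⟩ : ∃ q, q = y ^ 2 - c * y + 1 := ⟨_, rfl⟩
    rw [← hqy] at hq ⊢
    field_simp
    rw [hqy]
    ring
  have hneg : 0 < 2 * c * y - 2 * y ^ 2 - 1 := by nlinarith
  have : 0 < (c * y - 1) * (2 * c * y - 2 * y ^ 2 - 1) / (y * (y ^ 2 - c * y + 1)) :=
    div_pos (mul_pos (by linarith) hneg) (by positivity)
  linarith

lemma inv_le_apply_apply_one (h₁ : 1 < c) (h₂ : c < 2) :
    c⁻¹ ≤ normMap c (normMap c 1) := by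
  have ha : 2 - c ≤ c⁻¹ := by
    rw [le_inv_comm₀ (by linarith) (by linarith), ← one_div, le_div_iff₀ (by linarith)]
    nlinarith [sq_nonneg (c - 1)]
  have hci : c⁻¹ < 1 := inv_lt_one_of_one_lt₀ h₁
  calc c⁻¹ = normMap c c⁻¹ := (apply_inv c).symm
    _ ≤ normMap c (normMap c 1) := by
      rw [apply_one]
      exact antitoneOn_Ioc c ⟨by linarith, by linarith⟩ ⟨by positivity, hci.le⟩ ha

/-- Below the fixed point the map is bounded by its value at the critical value. -/
lemma apply_le_apply_apply_one (h₁ : 1 < c) (h₂ : c < 2) (hy : 2 - c ≤ y) (hy' : y ≤ c⁻¹) :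
    normMap c y ≤ normMap c (normMap c 1) := by
  have hci : c⁻¹ < 1 := inv_lt_one_of_one_lt₀ h₁
  rw [apply_one]
  exact antitoneOn_Ioc c ⟨by linarith, by linarith⟩ ⟨by linarith, by linarith⟩ hy

lemma le_of_isPeriodicPt (h₁ : 1 < c) (h₂ : c < 2) (hy : 2 - c ≤ y) {p : ℕ} (hp : 0 < p)
    (hper : (normMap c)^[p] y = y) : y ≤ normMap c (normMap c 1) := by
  by_contra! hlt
  have hmaps : MapsTo (normMap c) (Ico (2 - c) y) (Ico (2 - c) y) := fun w hw => by
    refine ⟨ge_of_pos (by linarith [hw.1]), ?_⟩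
    rcases le_total w c⁻¹ with h | h
    · exact (apply_le_apply_apply_one h₁ h₂ hw.1 h).trans_lt hlt
    · exact (le_self (by linarith) h).trans_lt hw.2
  obtain ⟨k, rfl⟩ := Nat.exists_eq_add_of_lt hp
  have hfy : normMap c y ∈ Ico (2 - c) y :=
    ⟨ge_of_pos (by linarith), lt_self (by linarith)
      ((inv_le_apply_apply_one h₁ h₂).trans_lt hlt)⟩
  have := (hmaps.iterate k hfy).2
  rw [← iterate_succ_apply, show k.succ = 0 + k + 1 by omega, hper] at this
  exact this.false

/-- If the second image of the critical point is at most `c`, the two sides of the fixed point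
are interchanged, so that it is the only point of odd period. -/
lemma eq_inv_of_odd (h₁ : 1 < c) (h₂ : c < 2) (hle : normMap c (normMap c 1) ≤ c)
    (hy : 2 - c ≤ y) {p : ℕ} (hp : Odd p) (hper : (normMap c)^[p] y = y) : y = c⁻¹ := by
  have hc0 : 0 < c := by linarith
  have hci : c⁻¹ < 1 := inv_lt_one_of_one_lt₀ h₁
  set L : Set ℝ := Icc (2 - c) c⁻¹
  set R : Set ℝ := Icc c⁻¹ (normMap c (normMap c 1))
  have hLR : MapsTo (normMap c) L R := fun w hw => by
    refine ⟨?_, apply_le_apply_apply_one h₁ h₂ hw.1 hw.2⟩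
    rw [← apply_inv c]
    exact antitoneOn_Ioc c ⟨by linarith [hw.1], hw.2.trans hci.le⟩
      ⟨by positivity, hci.le⟩ hw.2
  have hRL : MapsTo (normMap c) R L := fun w hw =>
    ⟨ge_of_pos ((inv_pos.2 hc0).trans_le hw.1), apply_le_inv hc0 hw.1 (hw.2.trans hle)⟩
  obtain ⟨k, rfl⟩ := hp
  have hsucc (w : ℝ) : (normMap c)^[2 * k + 1] w = ((normMap c)^[2])^[k] (normMap c w) := by
    rw [← iterate_mul, ← iterate_succ_apply]
  have hyM := le_of_isPeriodicPt h₁ h₂ hy (Nat.succ_pos _) hper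
  rcases le_total y c⁻¹ with h | h
  · have hR : (normMap c)^[2 * k + 1] y ∈ R := by
      rw [hsucc]
      exact (hLR.comp hRL).iterate k (hLR ⟨hy, h⟩)
    rw [hper] at hR
    exact h.antisymm hR.1
  · have hL : (normMap c)^[2 * k + 1] y ∈ L := by
      rw [hsucc]
      exact (hRL.comp hLR).iterate k (hRL ⟨h, hyM⟩)
    rw [hper] at hL
    exact hL.2.antisymm h

/-- The second iterate pushes points away from the fixed point, beyond the critical point. -/
lemma exists_one_le_iterate (hc : 5 / 3 < c) (h₂ : c < 2) (hy : c⁻¹ < y) :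
    ∃ k, 1 ≤ ((normMap c)^[2])^[k] y := by
  by_contra! hlt
  set u : ℕ → ℝ := fun k => ((normMap c)^[2])^[k] y
  have hsucc (k : ℕ) : u (k + 1) = normMap c (normMap c (u k)) :=
    iterate_succ_apply' _ _ _
  have hgt (k : ℕ) : c⁻¹ < u k := by
    induction k with
    | zero => exact hy
    | succ k ih =>
      rw [hsucc]
      exact ih.trans (lt_apply_apply hc h₂ ih (hlt k).le)
  have hmono : Monotone u := monotone_nat_of_le_succ fun k => by
    rw [hsucc]
    exact (lt_apply_apply hc h₂ (hgt k) (hlt k).le).le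
  have hbdd : BddAbove (range u) := ⟨1, by rintro _ ⟨k, rfl⟩; exact (hlt k).le⟩
  have hlim := tendsto_atTop_ciSup hmono hbdd
  set l := ⨆ k, u k
  have hyl : c⁻¹ < l := hy.trans_le (le_ciSup hbdd 0)
  have hl1 : l ≤ 1 := ciSup_le fun k => (hlt k).le
  have hl0 : 0 < l := (inv_pos.2 (by linarith)).trans hyl
  have hcont : ContinuousAt (normMap c)^[2] l :=
    (continuousOn_iterate h₂ 2).continuousAt (Ioi_mem_nhds hl0)
  have hfix : normMap c (normMap c l) = l := isFixedPt_of_tendsto_iterate hlim hcont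
  exact (lt_apply_apply hc h₂ hyl hl1).ne' hfix

lemma iterate_param (c : ℝ) (k : ℕ) : (normMap c)^[k + 1] c = c⁻¹ := by
  rw [iterate_succ_apply, apply_param]
  exact iterate_fixed (apply_inv c) k

lemma exists_odd_iterate_eq (hc : 5 / 3 < c) (h₂ : c < 2) :
    ∃ y, c ≤ y ∧ ∃ n, Odd n ∧ (normMap c)^[n] y = y := by
  have h₁ : 1 < c := by linarith
  have hci : c⁻¹ < 1 := inv_lt_one_of_one_lt₀ h₁
  set M := normMap c (normMap c 1)
  have hM : c < M := (lt_apply_apply_one_iff h₁ h₂).2 hc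
  obtain ⟨k, hk⟩ := exists_one_le_iterate hc h₂ (inv_lt_apply h₁ hM)
  rw [← iterate_mul, ← iterate_succ_apply] at hk
  have hcont (n : ℕ) (x : ℝ) : ContinuousOn (normMap c)^[n] (Icc c x) :=
    (continuousOn_iterate h₂ n).mono fun w hw => mem_Ioi.2 (by linarith [hw.1])
  obtain ⟨x, hx, hx1⟩ : 1 ∈ (normMap c)^[2 * k + 1] '' Icc c M :=
    intermediate_value_Icc hM.le (hcont _ _) ⟨by rw [iterate_param]; exact hci.le, hk⟩
  have hxM : (normMap c)^[2 * k + 3] x = M := by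
    rw [show 2 * k + 3 = 2 + (2 * k + 1) by ring, iterate_add_apply, hx1]
    rfl
  obtain ⟨y, hy, hy0⟩ : 0 ∈ (fun w => (normMap c)^[2 * k + 3] w - w) '' Icc c x := by
    refine intermediate_value_Icc hx.1 ((hcont _ _).sub continuousOn_id) ⟨?_, ?_⟩ <;>
      simp only [Pi.sub_apply, id_eq]
    · rw [iterate_param]
      linarith
    · rw [hxM]
      linarith [hx.2]
  exact ⟨y, hy.1, 2 * k + 3, ⟨k + 1, by ring⟩, sub_eq_zero.1 hy0⟩

theorem exists_odd_period_iff (h₁ : 1 < c) (h₂ : c < 2) :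
    (∃ y ∈ Icc (normMap c 1) (normMap c (normMap c 1) + 1), ∃ p : ℕ, Odd p ∧ 1 < p ∧
      (normMap c)^[p] y = y ∧ ∀ k : ℕ, 0 < k → k < p → (normMap c)^[k] y ≠ y) ↔ 5 / 3 < c := by
  constructor
  · rintro ⟨y, hy, p, hp, hp1, hper, hmin⟩
    rw [← lt_apply_apply_one_iff h₁ h₂]
    by_contra! hle
    rw [apply_one] at hy
    have := eq_inv_of_odd h₁ h₂ hle hy.1 hp hper
    exact hmin 1 one_pos hp1 (by rw [this]; exact apply_inv c)
  · intro hc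
    obtain ⟨y, hcy, n, hn, hper⟩ := exists_odd_iterate_eq hc h₂
    have hay : 2 - c ≤ y := by linarith
    have hyM := le_of_isPeriodicPt h₁ h₂ hay hn.pos hper
    have hodd : Odd (minimalPeriod (normMap c) y) :=
      hn.of_dvd_nat (IsPeriodicPt.minimalPeriod_dvd hper)
    refine ⟨y, ⟨by rwa [apply_one], by linarith⟩, minimalPeriod (normMap c) y, hodd, ?_,
      iterate_minimalPeriod, fun k hk hkp => not_isPeriodicPt_of_pos_of_lt_minimalPeriod hk.ne' hkp⟩
    refine lt_of_le_of_ne hodd.pos fun h => ?_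
    have hfix : normMap c y = y := minimalPeriod_eq_one_iff_isFixedPt.1 h.symm
    have := apply_eq_self hfix
    linarith [inv_lt_one_of_one_lt₀ h₁]

end normMap

/-- Under `β/(8(1−α)²) < λ < β/(2(1−α)²)`, the restriction of `f`
to `E = [f(s), f²(s)+s]` has a periodic point of odd period greater than `1`
iff `25β/(72(1−α)²) < λ`. -/
theorem stmt_4 (α β lam : ℝ) (hα : α ∈ Set.Ioo (0:ℝ) 1) (hβ : β ∈ Set.Ioo (0:ℝ) 1)
    (hlam : 0 < lam)
    (f : ℝ → ℝ) (hf : ∀ p : ℝ, f p = p + lam * (2 * β / p - 4 * (1 - α)))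
    (s : ℝ) (hs : s = Real.sqrt (2 * lam * β))
    (h1 : β / (8 * (1 - α) ^ 2) < lam) (h2 : lam < β / (2 * (1 - α) ^ 2)) :
    (∃ x ∈ Set.Icc (f s) (f (f s) + s), ∃ p : ℕ, Odd p ∧ 1 < p ∧ f^[p] x = x ∧
        ∀ k : ℕ, 0 < k → k < p → f^[k] x ≠ x) ↔
      25 * β / (72 * (1 - α) ^ 2) < lam := by
  have hβ0 := hβ.1
  have hα1 : 0 < 1 - α := by linarith [hα.2]
  have hs0 : 0 < s := by rw [hs]; positivity
  have hs2 : s ^ 2 = 2 * lam * β := by rw [hs, Real.sq_sqrt (by positivity)]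
  obtain ⟨c, hc⟩ : ∃ c, c = 4 * lam * (1 - α) / s := ⟨_, rfl⟩
  have hc0 : 0 < c := by rw [hc]; positivity
  have hc2 : c ^ 2 * β = 8 * lam * (1 - α) ^ 2 := by
    rw [hc, div_pow, hs2]
    field_simp
    ring
  rw [div_lt_iff₀ (by positivity)] at h1
  rw [lt_div_iff₀ (by positivity)] at h2
  have hc1 : 1 < c := by
    have : 1 < c ^ 2 := lt_of_mul_lt_mul_right (a := β) (by linarith) hβ0.le
    nlinarith
  have hc2' : c < 2 := by
    have : c ^ 2 < 4 := lt_of_mul_lt_mul_right (a := β) (by linarith) hβ0.le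
    nlinarith
  have hconj : Semiconj (s * ·) (normMap c) f := fun y => by
    have : 4 * lam * (1 - α) = s * c := by rw [hc]; field_simp
    rcases eq_or_ne y 0 with rfl | hy
    · simp only [normMap, hf, mul_zero, div_zero, inv_zero]
      linarith
    · have h : lam * (2 * β / (s * y)) = s * y⁻¹ := by
        field_simp
        linarith
      simp only [normMap, hf]
      linear_combination this - h
  have hiter (k : ℕ) (y : ℝ) : f^[k] (s * y) = s * (normMap c)^[k] y :=
    ((hconj.iterate_right k) y).symm
  have hf1 : f s = s * normMap c 1 := by simpa using (hconj 1).symm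
  have hf2 : f (f s) = s * normMap c (normMap c 1) := by rw [hf1]; exact (hconj _).symm
  have hthr : 25 * β / (72 * (1 - α) ^ 2) < lam ↔ 5 / 3 < c := by
    rw [div_lt_iff₀ (by positivity)]
    constructor
    · intro h
      have : 25 / 9 < c ^ 2 := lt_of_mul_lt_mul_right (a := β) (by linarith) hβ0.le
      nlinarith
    · intro h
      have : 25 / 9 < c ^ 2 := by nlinarith
      have := mul_lt_mul_of_pos_right this hβ0
      linarith
  rw [hthr, ← normMap.exists_odd_period_iff hc1 hc2', hf2, hf1,
    (mul_left_surjective₀ hs0.ne').exists]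
  refine exists_congr fun y => and_congr ?_ ?_
  · rw [mem_Icc, mem_Icc, mul_le_mul_iff_right₀ hs0,
      show s * normMap c (normMap c 1) + s = s * (normMap c (normMap c 1) + 1) by ring,
      mul_le_mul_iff_right₀ hs0]
  · simp only [hiter, ne_eq, mul_right_inj' hs0.ne']
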